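/- (Theorem 6.) Suppose that for every ω ∈ ℝ the matrices K(I*ω) and K(I*ω) + F are invertible, that ‖(K(I*ω))⁻¹‖ ≤ κ and ‖(K(I*ω))⁻¹ * B(I*ω)‖ ≤ β for all real ω, and that κ * ‖F‖ < 1. Assume furthermore that the functions ω ↦ ‖C(I*ω) * (K(I*ω))⁻¹‖_F² and ω ↦ ‖C(I*ω) * ((K(I*ω))⁻¹ − (K(I*ω) + F)⁻¹) * B(I*ω)‖_F² are integrable over ℝ. Then (1/(2π)) * ∫ ‖C(I*ω) * ((K(I*ω))⁻¹ − (K(I*ω) + F)⁻¹) * B(I*ω)‖_F² dω ≤ ( β * ‖F‖ / (1 − κ * ‖F‖) )² * (1/(2π)) * ∫ ‖C(I*ω) * (K(I*ω))⁻¹‖_F² dω. -/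

import Mathlib

open Matrix MeasureTheory

/-- Spectral (Euclidean operator) norm of a matrix. -/
noncomputable def mnorm {k l : ℕ} (M : Matrix (Fin k) (Fin l) ℂ) : ℝ :=
  ‖LinearMap.toContinuousLinearMap (Matrix.toEuclideanLin M)‖

/-- Frobenius norm of a matrix. -/
noncomputable def fnorm {k l : ℕ} (M : Matrix (Fin k) (Fin l) ℂ) : ℝ :=
  Real.sqrt (∑ i, ∑ j, ‖M i j‖ ^ 2)

open scoped Matrix.Norms.L2Operator in
theorem mnorm_eq_l2_opNorm {k l : ℕ} (M : Matrix (Fin k) (Fin l) ℂ) : mnorm M = ‖M‖ := rfl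

theorem mnorm_nonneg {k l : ℕ} (M : Matrix (Fin k) (Fin l) ℂ) : 0 ≤ mnorm M := norm_nonneg _

theorem fnorm_nonneg {k l : ℕ} (M : Matrix (Fin k) (Fin l) ℂ) : 0 ≤ fnorm M := Real.sqrt_nonneg _

theorem mnorm_mul_le {k l r : ℕ} (M : Matrix (Fin k) (Fin l) ℂ) (N : Matrix (Fin l) (Fin r) ℂ) :
    mnorm (M * N) ≤ mnorm M * mnorm N :=
  l2_opNorm_mul M N

open scoped Matrix.Norms.L2Operator in
theorem mnorm_sub_le {k l : ℕ} (M N : Matrix (Fin k) (Fin l) ℂ) :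
    mnorm (M - N) ≤ mnorm M + mnorm N := by
  simpa only [mnorm_eq_l2_opNorm] using norm_sub_le M N

theorem mnorm_conjTranspose {k l : ℕ} (M : Matrix (Fin k) (Fin l) ℂ) : mnorm Mᴴ = mnorm M :=
  l2_opNorm_conjTranspose M

theorem fnorm_sq {k l : ℕ} (M : Matrix (Fin k) (Fin l) ℂ) :
    fnorm M ^ 2 = ∑ i, ∑ j, ‖M i j‖ ^ 2 :=
  Real.sq_sqrt (by positivity)

theorem fnorm_sq_eq_sum_norm_star_row {k l : ℕ} (M : Matrix (Fin k) (Fin l) ℂ) :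
    fnorm M ^ 2 = ∑ i, ‖WithLp.toLp 2 (star (M i))‖ ^ 2 := by
  simp [fnorm_sq, EuclideanSpace.norm_sq_eq]

/-- The Frobenius norm is submultiplicative with respect to the spectral norm on the right. -/
theorem fnorm_mul_le {k l r : ℕ} (M : Matrix (Fin k) (Fin l) ℂ) (N : Matrix (Fin l) (Fin r) ℂ) :
    fnorm (M * N) ≤ fnorm M * mnorm N := by
  refine le_of_sq_le_sq ?_ (mul_nonneg (fnorm_nonneg M) (mnorm_nonneg N))
  rw [mul_pow, fnorm_sq_eq_sum_norm_star_row, fnorm_sq_eq_sum_norm_star_row, Finset.sum_mul]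
  refine Finset.sum_le_sum fun i _ => ?_
  have hrow : star ((M * N) i) = Nᴴ *ᵥ star (M i) := by
    rw [← star_vecMul]
    rfl
  rw [hrow, ← mul_pow, ← mnorm_conjTranspose N, mul_comm]
  gcongr
  exact l2_opNorm_mulVec Nᴴ (WithLp.toLp 2 (star (M i)))

theorem inv_sub_inv_add {R : Type*} [CommRing R] {n : Type*} [Fintype n] [DecidableEq n]
    {K F : Matrix n n R} (hK : IsUnit K) (hKF : IsUnit (K + F)) :
    K⁻¹ - (K + F)⁻¹ = K⁻¹ * F * (K + F)⁻¹ := by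
  rw [isUnit_iff_isUnit_det] at hK hKF
  calc K⁻¹ - (K + F)⁻¹ = K⁻¹ * ((K + F) * (K + F)⁻¹) - K⁻¹ * K * (K + F)⁻¹ := by
        rw [mul_nonsing_inv _ hKF, nonsing_inv_mul _ hK, mul_one, one_mul]
    _ = K⁻¹ * F * (K + F)⁻¹ := by noncomm_ring

/-- Neumann-type bound for the perturbed solution operator. -/
theorem mnorm_inv_add_mul_le {n m : ℕ} {κ β : ℝ} {K F : Matrix (Fin n) (Fin n) ℂ}
    {B : Matrix (Fin n) (Fin m) ℂ} (hK : IsUnit K) (hKF : IsUnit (K + F))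
    (hκ : mnorm K⁻¹ ≤ κ) (hβ : mnorm (K⁻¹ * B) ≤ β) (hsmall : κ * mnorm F < 1) :
    mnorm ((K + F)⁻¹ * B) ≤ β / (1 - κ * mnorm F) := by
  have hid : (K + F)⁻¹ * B = K⁻¹ * B - K⁻¹ * F * ((K + F)⁻¹ * B) := by
    rw [← Matrix.mul_assoc, ← inv_sub_inv_add hK hKF, Matrix.sub_mul, sub_sub_cancel]
  have hle : mnorm ((K + F)⁻¹ * B) ≤ β + κ * mnorm F * mnorm ((K + F)⁻¹ * B) := by
    calc mnorm ((K + F)⁻¹ * B) = mnorm (K⁻¹ * B - K⁻¹ * F * ((K + F)⁻¹ * B)) := by rw [← hid]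
      _ ≤ mnorm (K⁻¹ * B) + mnorm (K⁻¹ * F * ((K + F)⁻¹ * B)) := mnorm_sub_le _ _
      _ ≤ β + mnorm K⁻¹ * mnorm F * mnorm ((K + F)⁻¹ * B) := by
        refine add_le_add hβ ((mnorm_mul_le _ _).trans ?_)
        exact mul_le_mul_of_nonneg_right (mnorm_mul_le _ _) (mnorm_nonneg _)
      _ ≤ β + κ * mnorm F * mnorm ((K + F)⁻¹ * B) := by
        have := mnorm_nonneg F
        have := mnorm_nonneg ((K + F)⁻¹ * B)
        gcongr
  rw [le_div_iff₀ (sub_pos.2 hsmall)]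
  linarith

theorem fnorm_backward_error_le {n m p : ℕ} {κ β : ℝ} {K F : Matrix (Fin n) (Fin n) ℂ}
    {B : Matrix (Fin n) (Fin m) ℂ} (C : Matrix (Fin p) (Fin n) ℂ)
    (hK : IsUnit K) (hKF : IsUnit (K + F))
    (hκ : mnorm K⁻¹ ≤ κ) (hβ : mnorm (K⁻¹ * B) ≤ β) (hsmall : κ * mnorm F < 1) :
    fnorm (C * (K⁻¹ - (K + F)⁻¹) * B) ≤
      β * mnorm F / (1 - κ * mnorm F) * fnorm (C * K⁻¹) := by
  have hfactor : C * (K⁻¹ - (K + F)⁻¹) * B = C * K⁻¹ * (F * ((K + F)⁻¹ * B)) := by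
    rw [inv_sub_inv_add hK hKF]
    simp only [Matrix.mul_assoc]
  calc fnorm (C * (K⁻¹ - (K + F)⁻¹) * B)
      ≤ fnorm (C * K⁻¹) * mnorm (F * ((K + F)⁻¹ * B)) := hfactor ▸ fnorm_mul_le _ _
    _ ≤ fnorm (C * K⁻¹) * (mnorm F * (β / (1 - κ * mnorm F))) := by
      refine mul_le_mul_of_nonneg_left ((mnorm_mul_le _ _).trans ?_) (fnorm_nonneg _)
      exact mul_le_mul_of_nonneg_left (mnorm_inv_add_mul_le hK hKF hκ hβ hsmall) (mnorm_nonneg _)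
    _ = β * mnorm F / (1 - κ * mnorm F) * fnorm (C * K⁻¹) := by ring

/-- Theorem 6: the H₂-norm of the system-wise backward error `H - H̃` is controlled
in terms of the backward perturbation `F`. -/
theorem backward_error_H2_bound
    {n m p : ℕ} (hn : 0 < n) (hm : 0 < m) (hp : 0 < p)
    (κ β : ℝ) (hκ : 0 ≤ κ) (hβ : 0 ≤ β)
    (K : ℂ → Matrix (Fin n) (Fin n) ℂ)
    (B : ℂ → Matrix (Fin n) (Fin m) ℂ)
    (C : ℂ → Matrix (Fin p) (Fin n) ℂ)
    (F : Matrix (Fin n) (Fin n) ℂ)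
    (hK : ∀ ω : ℝ, IsUnit (K (Complex.I * ω)))
    (hKF : ∀ ω : ℝ, IsUnit (K (Complex.I * ω) + F))
    (hκbound : ∀ ω : ℝ, mnorm ((K (Complex.I * ω))⁻¹) ≤ κ)
    (hβbound : ∀ ω : ℝ, mnorm ((K (Complex.I * ω))⁻¹ * B (Complex.I * ω)) ≤ β)
    (hsmall : κ * mnorm F < 1)
    (hint₁ : Integrable (fun ω : ℝ =>
      (fnorm (C (Complex.I * ω) * (K (Complex.I * ω))⁻¹)) ^ 2))
    (hint₂ : Integrable (fun ω : ℝ =>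
      (fnorm (C (Complex.I * ω) *
        ((K (Complex.I * ω))⁻¹ - (K (Complex.I * ω) + F)⁻¹) * B (Complex.I * ω))) ^ 2)) :
    (1 / (2 * Real.pi)) * ∫ ω : ℝ,
        (fnorm (C (Complex.I * ω) *
          ((K (Complex.I * ω))⁻¹ - (K (Complex.I * ω) + F)⁻¹) * B (Complex.I * ω))) ^ 2 ≤
      (β * mnorm F / (1 - κ * mnorm F)) ^ 2 *
        ((1 / (2 * Real.pi)) * ∫ ω : ℝ,
          (fnorm (C (Complex.I * ω) * (K (Complex.I * ω))⁻¹)) ^ 2) := by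
  rw [mul_left_comm, ← integral_const_mul ((β * mnorm F / (1 - κ * mnorm F)) ^ 2)]
  refine mul_le_mul_of_nonneg_left ?_ (one_div_nonneg.2 Real.two_pi_pos.le)
  refine integral_mono hint₂ (hint₁.const_mul _) fun ω => ?_
  simp only [← mul_pow]
  exact pow_le_pow_left₀ (fnorm_nonneg _)
    (fnorm_backward_error_le _ (hK ω) (hKF ω) (hκbound ω) (hβbound ω) hsmall) 2
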